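/- arXiv:1901.01203 — 3 statements merged into one kernel-verified Lean document; each statement's English description precedes it below -/
import Mathlib

section
/- The set of admissible 5-tuples (λ, g, Δ, d, a) ∈ ℤ⁵ is finite of cardinality 3619; exactly 2480 of its elements have d ≠ 1, and exactly 1139 of its elements have d = 1. -/
/-- The admissibility predicate from Lemma 2.2 of the paper. -/
def Admissible (l g D d a : ℤ) : Prop :=
  3 ≤ l ∧ l ≤ 27 ∧ 0 ≤ g ∧
  2 * g ≤ ((l - 2) / 3) * (2 * l - 8 - 3 * ((l - 2) / 3 - 1)) ∧
  1 ≤ d ∧ d ≤ 5 ∧ 1 ≤ D ∧ 0 ≤ a ∧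
  (d = 5 ↔ D = 1) ∧ (d = 4 ↔ D = 2) ∧
  (D = 1 → a = 0) ∧ (D = 2 → a = 1) ∧ (3 ≤ D → 1 ≤ a) ∧
  0 ≤ 2 * l - g + 1 ∧
  0 ≤ -21 * l + 6 * g - D * d + 237 ∧
  0 ≤ l ^ 2 + 9 * l - 18 * g + 18 ∧
  0 ≤ 49 * l ^ 2 - 28 * l * g + 4 * g ^ 2 + (D * d - 1106) * l + 316 * g - 27 * (D * d) + 6241 ∧
  0 ≤ 7 * D * l - 2 * D * g + D ^ 2 * d ^ 2 - 79 * D ∧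
  0 ≤ l ^ 2 + 7 * l - 10 * g - 2 * (D * d) + 12 * a - 12 * (if d = 1 then (1 : ℤ) else 0) - 92 ∧
  0 ≤ -10 * l + 8 * g + 2 * (D * d) - 12 * a + 12 * (if d = 1 then (1 : ℤ) else 0) + 94 ∧
  0 ≤ -290 * l + 140 * g - 13 * (D * d) + D + 2290 ∧
  0 ≤ -147 * l + 74 * g + 12 * (D * d) - D - 84 * a + 108 * (if d = 1 then (1 : ℤ) else 0) + 1183

/-- The integers `0, …, n - 1`. -/
def rng (n : ℕ) : List ℤ := (List.range n).map (fun k : ℕ => (k : ℤ))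

theorem mem_rng (n : ℕ) (x : ℤ) : x ∈ rng n ↔ 0 ≤ x ∧ x < n := by
  simp only [rng, List.mem_map, List.mem_range]
  constructor
  · rintro ⟨k, hk, rfl⟩
    omega
  · rintro ⟨h0, h1⟩
    exact ⟨x.toNat, by omega, by omega⟩

/-- Conditions on `l, g` only. -/
def c1 (l g : ℤ) : Bool :=
  decide (3 ≤ l) && decide (2 * g ≤ ((l - 2) / 3) * (2 * l - 8 - 3 * ((l - 2) / 3 - 1))) &&
  decide (0 ≤ 2 * l - g + 1) && decide (0 ≤ l * l + 9 * l - 18 * g + 18)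

/-- Conditions on `l, g, D, d` only. -/
def c2 (l g D d : ℤ) : Bool :=
  decide (1 ≤ d) && decide (1 ≤ D) && decide (d = 5 ↔ D = 1) && decide (d = 4 ↔ D = 2) &&
  decide (0 ≤ -21 * l + 6 * g - D * d + 237) &&
  decide (0 ≤ 49 * (l * l) - 28 * l * g + 4 * (g * g) + (D * d - 1106) * l + 316 * g
    - 27 * (D * d) + 6241) &&
  decide (0 ≤ 7 * D * l - 2 * D * g + (D * d) * (D * d) - 79 * D) &&
  decide (0 ≤ -290 * l + 140 * g - 13 * (D * d) + D + 2290)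

/-- The lower bound for `a`; `e` is the value of the indicator of `d = 1`. -/
def lo (l g D d e : ℤ) : ℤ :=
  max (if D = 1 then 0 else 1) (-((l * l + 7 * l - 10 * g - 2 * (D * d) - 12 * e - 92) / 12))

/-- The upper bound for `a`, from the general inequalities. -/
def hi₀ (l g D d e : ℤ) : ℤ :=
  min ((-10 * l + 8 * g + 2 * (D * d) + 12 * e + 94) / 12)
    ((-147 * l + 74 * g + 12 * (D * d) - D + 108 * e + 1183) / 84)

/-- The upper bound for `a`. -/
def hi (l g D d e : ℤ) : ℤ :=
  if D ≤ 2 then min (D - 1) (hi₀ l g D d e) else hi₀ l g D d e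

theorem bounds_iff (l g D d e a : ℤ) (hD : 1 ≤ D) :
    (lo l g D d e ≤ a ∧ a ≤ hi l g D d e) ↔
      0 ≤ a ∧ (D = 1 → a = 0) ∧ (D = 2 → a = 1) ∧ (3 ≤ D → 1 ≤ a) ∧
      0 ≤ l ^ 2 + 7 * l - 10 * g - 2 * (D * d) + 12 * a - 12 * e - 92 ∧
      0 ≤ -10 * l + 8 * g + 2 * (D * d) - 12 * a + 12 * e + 94 ∧
      0 ≤ -147 * l + 74 * g + 12 * (D * d) - D - 84 * a + 108 * e + 1183 := by
  have e1 : l * l = l ^ 2 := by ring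
  unfold lo hi hi₀
  rw [e1]
  generalize D * d = P
  generalize l ^ 2 = Q
  constructor
  · rintro ⟨h1, h2⟩
    refine ⟨?_, ?_, ?_, ?_, ?_, ?_, ?_⟩ <;> split_ifs at h1 h2 <;> omega
  · rintro ⟨h1, h2, h3, h4, h5, h6, h7⟩
    constructor <;> split_ifs <;> omega

/-- The admissible tuples with given `l, g, d, D`. -/
def innerT (l g D d e : ℤ) : List (ℤ × ℤ × ℤ × ℤ × ℤ) :=
  if c2 l g D d = true then
    (rng (hi l g D d e + 1 - lo l g D d e).toNat).map (fun k => (l, g, D, d, lo l g D d e + k))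
  else []

/-- A strict upper bound for `D`. -/
def dBound (l g d : ℤ) : ℕ :=
  if 4 ≤ d then 3
  else ((min (-21 * l + 6 * g + 237) ((-290 * l + 140 * g + 2290) / 12)) / d + 1).toNat

theorem lt_dBound (l g D d : ℤ) (hd : 1 ≤ d) (hd5 : d ≤ 5) (hD : 1 ≤ D) (h5 : d = 5 ↔ D = 1)
    (h4 : d = 4 ↔ D = 2) (hM : 0 ≤ -21 * l + 6 * g - D * d + 237)
    (hK : 0 ≤ -290 * l + 140 * g - 13 * (D * d) + D + 2290) : D < (dBound l g d : ℤ) := by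
  unfold dBound
  split_ifs with h
  · have : (((3 : ℕ) : ℤ)) = 3 := rfl
    omega
  · have hDd : D ≤ D * d := by nlinarith
    have h1 : D ≤ (min (-21 * l + 6 * g + 237) ((-290 * l + 140 * g + 2290) / 12)) / d := by
      apply (Int.le_ediv_iff_mul_le (by omega)).2
      generalize D * d = P at *
      omega
    omega

/-- The admissible tuples with given `l, g`. -/
def middle (l g : ℤ) : List (ℤ × ℤ × ℤ × ℤ × ℤ) :=
  if c1 l g = true then
    (rng 6).flatMap fun d => (rng (dBound l g d)).flatMap fun D =>
      innerT l g D d (if d = 1 then 1 else 0)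
  else []

/-- All admissible tuples. -/
def allTuples : List (ℤ × ℤ × ℤ × ℤ × ℤ) :=
  (rng 28).flatMap fun l => (rng 56).flatMap fun g => middle l g

/-- An integer key that increases along `allTuples`. -/
def key (p : ℤ × ℤ × ℤ × ℤ × ℤ) : ℤ :=
  (((p.1 * 1000 + p.2.1) * 1000 + p.2.2.2.1) * 1000 + p.2.2.1) * 1000 + p.2.2.2.2

/-- Checks that the keys increase strictly, starting above `k`. -/
def incr : ℤ → List (ℤ × ℤ × ℤ × ℤ × ℤ) → Bool
  | _, [] => true
  | k, p :: t => decide (k < key p) && incr (key p) t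

theorem incr_spec (L : List (ℤ × ℤ × ℤ × ℤ × ℤ)) :
    ∀ k, incr k L = true → (∀ p ∈ L, k < key p) ∧ L.Nodup := by
  induction L with
  | nil => intro k _; simp
  | cons p t ih =>
    intro k h
    simp only [incr, Bool.and_eq_true, decide_eq_true_eq] at h
    obtain ⟨h1, h2⟩ := ih _ h.2
    refine ⟨?_, ?_⟩
    · intro q hq
      rcases List.mem_cons.1 hq with rfl | hq
      · exact h.1
      · exact h.1.trans (h1 q hq)
    · refine List.nodup_cons.2 ⟨fun hp => ?_, h2⟩
      exact lt_irrefl _ (h1 p hp)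

theorem mem_all (l g D d a : ℤ) : (l, g, D, d, a) ∈ allTuples ↔ Admissible l g D d a := by
  have hm : (l, g, D, d, a) ∈ allTuples ↔
      (0 ≤ l ∧ l < 28) ∧ (0 ≤ g ∧ g < 56) ∧ c1 l g = true ∧ (0 ≤ d ∧ d < 6) ∧
      (0 ≤ D ∧ D < dBound l g d) ∧ c2 l g D d = true ∧
      (lo l g D d (if d = 1 then 1 else 0) ≤ a ∧ a ≤ hi l g D d (if d = 1 then 1 else 0)) := by
    unfold allTuples middle innerT
    simp only [List.mem_flatMap, mem_rng]
    constructor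
    · rintro ⟨l', hl, g', hg, h⟩
      split_ifs at h with h1
      · simp only [List.mem_flatMap, mem_rng] at h
        obtain ⟨d', hd, D', hD, h⟩ := h
        by_cases h2 : c2 l' g' D' d' = true
        · rw [if_pos h2] at h
          simp only [List.mem_map, mem_rng, Prod.mk.injEq] at h
          obtain ⟨a', ha, rfl, rfl, rfl, rfl, rfl⟩ := h
          exact ⟨hl, hg, h1, hd, hD, h2, by omega, by omega⟩
        · rw [if_neg h2] at h
          simp at h
      · simp at h
    · rintro ⟨hl, hg, h1, hd, hD, h2, ha⟩
      refine ⟨l, hl, g, hg, ?_⟩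
      rw [if_pos h1]
      simp only [List.mem_flatMap, mem_rng]
      refine ⟨d, hd, D, hD, ?_⟩
      rw [if_pos h2]
      simp only [List.mem_map, mem_rng]
      refine ⟨a - lo l g D d (if d = 1 then 1 else 0), by omega, ?_⟩
      rw [add_sub_cancel]
  rw [hm]
  unfold Admissible
  generalize (if d = 1 then (1 : ℤ) else 0) = e
  have e1 : l * l = l ^ 2 := by ring
  have e2 : g * g = g ^ 2 := by ring
  have e3 : (D * d) * (D * d) = D ^ 2 * d ^ 2 := by ring
  unfold c1 c2
  simp only [Bool.and_eq_true, decide_eq_true_eq]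
  rw [e1, e2, e3]
  constructor
  · rintro ⟨⟨_, _⟩, ⟨_, _⟩, ⟨⟨⟨_, _⟩, _⟩, _⟩, ⟨_, _⟩, ⟨_, _⟩,
      ⟨⟨⟨⟨⟨⟨⟨_, hD⟩, _⟩, _⟩, _⟩, _⟩, _⟩, _⟩, hb⟩
    obtain ⟨_, _, _, _, _, _, _⟩ := (bounds_iff l g D d e a hD).1 hb
    refine ⟨?_, ?_, ?_, ?_, ?_, ?_, ?_, ?_, ?_, ?_, ?_, ?_, ?_, ?_, ?_, ?_, ?_, ?_, ?_, ?_, ?_, ?_⟩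
    all_goals first | assumption | omega
  · rintro ⟨_, _, _, _, hd, hd5, hD, k1, h5, h4, k2, k3, k4, _, _, _, _, _, k5, k6, _, k7⟩
    have hb : D < (dBound l g d : ℤ) := by
      apply lt_dBound <;> assumption
    have hab := (bounds_iff l g D d e a hD).2 ⟨k1, k2, k3, k4, k5, k6, k7⟩
    refine ⟨⟨?_, ?_⟩, ⟨?_, ?_⟩, ⟨⟨⟨?_, ?_⟩, ?_⟩, ?_⟩, ⟨?_, ?_⟩, ⟨?_, ?_⟩,
      ⟨⟨⟨⟨⟨⟨⟨?_, ?_⟩, ?_⟩, ?_⟩, ?_⟩, ?_⟩, ?_⟩, ?_⟩, hab⟩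
    all_goals first | assumption | omega

/-- All numerical facts about the list, as one computation. -/
def checkAll (L : List (ℤ × ℤ × ℤ × ℤ × ℤ)) : Bool :=
  incr 0 L && decide (L.length = 3619) &&
  decide ((L.filter fun p => decide (p.2.2.2.1 = 1)).length = 1139)

set_option maxRecDepth 100000 in
theorem check_true : checkAll allTuples = true := by decide +kernel

/-- Lemma 2.2: the set of admissible 5-tuples is finite of cardinality 3619,
with 2480 elements having `d ≠ 1` and 1139 elements having `d = 1`. -/
theorem admissible_count :
    ({p : ℤ × ℤ × ℤ × ℤ × ℤ |
        Admissible p.1 p.2.1 p.2.2.1 p.2.2.2.1 p.2.2.2.2}).Finite ∧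
    ({p : ℤ × ℤ × ℤ × ℤ × ℤ |
        Admissible p.1 p.2.1 p.2.2.1 p.2.2.2.1 p.2.2.2.2}).ncard = 3619 ∧
    ({p : ℤ × ℤ × ℤ × ℤ × ℤ |
        Admissible p.1 p.2.1 p.2.2.1 p.2.2.2.1 p.2.2.2.2 ∧ p.2.2.2.1 ≠ 1}).ncard = 2480 ∧
    ({p : ℤ × ℤ × ℤ × ℤ × ℤ |
        Admissible p.1 p.2.1 p.2.2.1 p.2.2.2.1 p.2.2.2.2 ∧ p.2.2.2.1 = 1}).ncard = 1139 := by
  have hc := check_true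
  simp only [checkAll, Bool.and_eq_true, decide_eq_true_eq] at hc
  obtain ⟨⟨hi, hl⟩, h1⟩ := hc
  have hnd := (incr_spec _ _ hi).2
  have hS : {p : ℤ × ℤ × ℤ × ℤ × ℤ | Admissible p.1 p.2.1 p.2.2.1 p.2.2.2.1 p.2.2.2.2} =
      (allTuples.toFinset : Set (ℤ × ℤ × ℤ × ℤ × ℤ)) := by
    ext ⟨l, g, D, d, a⟩
    simp [mem_all]
  have hS1 : {p : ℤ × ℤ × ℤ × ℤ × ℤ | Admissible p.1 p.2.1 p.2.2.1 p.2.2.2.1 p.2.2.2.2 ∧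
      p.2.2.2.1 = 1} = ((allTuples.filter fun p => decide (p.2.2.2.1 = 1)).toFinset :
        Set (ℤ × ℤ × ℤ × ℤ × ℤ)) := by
    ext ⟨l, g, D, d, a⟩
    simp [mem_all]
  have hfin : {p : ℤ × ℤ × ℤ × ℤ × ℤ |
      Admissible p.1 p.2.1 p.2.2.1 p.2.2.2.1 p.2.2.2.2}.Finite := by
    rw [hS]; exact Finset.finite_toSet _
  have hA : {p : ℤ × ℤ × ℤ × ℤ × ℤ |
      Admissible p.1 p.2.1 p.2.2.1 p.2.2.2.1 p.2.2.2.2}.ncard = 3619 := by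
    rw [hS, Set.ncard_coe_finset, List.toFinset_card_of_nodup hnd, hl]
  have hB : {p : ℤ × ℤ × ℤ × ℤ × ℤ | Admissible p.1 p.2.1 p.2.2.1 p.2.2.2.1 p.2.2.2.2 ∧
      p.2.2.2.1 = 1}.ncard = 1139 := by
    rw [hS1, Set.ncard_coe_finset, List.toFinset_card_of_nodup (hnd.filter _), h1]
  refine ⟨hfin, hA, ?_, hB⟩
  have hdiff : {p : ℤ × ℤ × ℤ × ℤ × ℤ | Admissible p.1 p.2.1 p.2.2.1 p.2.2.2.1 p.2.2.2.2 ∧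
      p.2.2.2.1 ≠ 1} =
      {p : ℤ × ℤ × ℤ × ℤ × ℤ | Admissible p.1 p.2.1 p.2.2.1 p.2.2.2.1 p.2.2.2.2} \
      {p : ℤ × ℤ × ℤ × ℤ × ℤ | Admissible p.1 p.2.1 p.2.2.1 p.2.2.2.1 p.2.2.2.2 ∧
        p.2.2.2.1 = 1} := by
    ext p
    exact ⟨fun h => ⟨h.1, fun h' => h.2 h'.2⟩, fun h => ⟨h.1, fun h' => h.2 ⟨h.1, h'⟩⟩⟩
  rw [hdiff, Set.ncard_sdiff (fun p hp => hp.1) (hfin.subset fun p hp => hp.1), hA, hB]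
end

section
/- The 6-tuples (λ, g, ν, Δ, d, a) ∈ ℤ⁶ such that (λ, g, Δ, d, a) ∈ Γ₁₇₄, ν ≥ 0, the Le Barz bound holds, and the three equations (K3 − 8ν) + (λ + ν) = 0, (K2H + 4ν) − (λ + ν) = 0, (KH2 − 2ν) + (λ + ν) = 0 all hold, is exactly the single tuple (11, 8, 3, 4, 3, 2). -/
/-- `CIFactor D s a` : there exist integers `e₁, …, e_a`, all `≥ 2`, with product `D` and sum `s`. -/
def CIFactor (D s a : ℤ) : Prop :=
  ∃ e : List ℤ, (e.length : ℤ) = a ∧ (∀ x ∈ e, 2 ≤ x) ∧ e.prod = D ∧ e.sum = s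

/-- The set Γ₁₇₄ from the proof of Theorem 2.3 of the paper. -/
def Gamma174 (l g D d a : ℤ) : Prop :=
  Admissible l g D d a ∧ d ≠ 1 ∧ CIFactor D (a + 5 - d) a

/-- `K_B · H_B²` for the base locus, from Lemma 2.1. -/
def KH2 (l g : ℤ) : ℤ := -2 * l + 2 * g - 2

/-- `K_B² · H_B` for the base locus, from Lemma 2.1. -/
def K2H (l g D d a : ℤ) : ℤ := -39 * l + 14 * g + D * d - 12 * a + 331

/-- `K_B³` for the base locus, from Lemma 2.1. -/
def K3 (l g D d a : ℤ) : ℤ := l ^ 2 - 77 * l + 14 * g - 3 * (D * d) - D - 12 * a + 688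

/-- The Le Barz quadrisecant bound on the number ν of exceptional divisors. -/
def LeBarz (l g ν D d a : ℤ) : Prop :=
  8 * ν ≤ l ^ 4 - 4 * l ^ 2 * (D * d) + 4 * D ^ 2 * d ^ 2 + 6 * l ^ 3 - 24 * l ^ 2 * g
    + 4 * l * (D * d) + 40 * g * (D * d) + 24 * l ^ 2 * a - 48 * (D * d) * a
    - 433 * l ^ 2 + 160 * l * g + 104 * g ^ 2 + 100 * (D * d) - 56 * l * a
    - 240 * g * a + 144 * a ^ 2 + 5650 * l - 784 * g - 168 * a - 23752

theorem ci_cases (D d a : ℤ) (hd : d ≠ 1) (h1 : 1 ≤ d) (h : CIFactor D (a + 5 - d) a) :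
    (D = 1 ∧ d = 5 ∧ a = 0) ∨ (D = 2 ∧ d = 4 ∧ a = 1) ∨ (D = 3 ∧ d = 3 ∧ a = 1) ∨
    (D = 4 ∧ d = 3 ∧ a = 2) ∨ (D = 4 ∧ d = 2 ∧ a = 1) ∨ (D = 6 ∧ d = 2 ∧ a = 2) ∨
    (D = 8 ∧ d = 2 ∧ a = 3) := by
  obtain ⟨e, hl, he, hp, hs⟩ := h
  match e with
  | [] => simp at hl hp hs; omega
  | [x] => simp at hl hp hs he; omega
  | [x, y] =>
    simp at hl hp hs he
    have hx : x ≤ 3 := by omega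
    have hy : y ≤ 3 := by omega
    obtain ⟨h2, h3⟩ := he
    interval_cases x <;> interval_cases y <;> omega
  | [x, y, z] =>
    simp at hl hp hs he
    obtain ⟨h2, h3, h4⟩ := he
    obtain rfl : x = 2 := by omega
    obtain rfl : y = 2 := by omega
    obtain rfl : z = 2 := by omega
    omega
  | x :: y :: z :: w :: t =>
    exfalso
    have key : ∀ t : List ℤ, (∀ x ∈ t, 2 ≤ x) → 2 * (t.length : ℤ) ≤ t.sum := by
      intro t
      induction t with
      | nil => simp
      | cons x t ih =>
        intro h
        have h5 := ih (fun y hy => h y (List.mem_cons_of_mem _ hy))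
        have h6 := h x List.mem_cons_self
        simp only [List.length_cons, List.sum_cons]
        push_cast
        omega
    have h7 := key _ he
    simp only [List.length_cons] at hl h7
    push_cast at hl h7
    omega

/-- In the proof of Theorem 2.3, the Mukai-variety case: the three equations select exactly
the tuple `(11, 8, 3, 4, 3, 2)`. -/
theorem mukai_case_solution (l g ν D d a : ℤ) :
    (Gamma174 l g D d a ∧ 0 ≤ ν ∧ LeBarz l g ν D d a ∧
      (K3 l g D d a - 8 * ν) + (l + ν) = 0 ∧
      (K2H l g D d a + 4 * ν) - (l + ν) = 0 ∧
      (KH2 l g - 2 * ν) + (l + ν) = 0)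
    ↔ (l, g, ν, D, d, a) = (11, 8, 3, 4, 3, 2) := by
  constructor
  · rintro ⟨⟨hA, hd, hC⟩, hν, hB, e1, e2, e3⟩
    obtain ⟨h1, h2, h3, h4, h5, hA⟩ := hA
    clear hB
    unfold K3 at e1
    unfold K2H at e2
    unfold KH2 at e3
    have hc := ci_cases D d a hd h5 hC
    clear hC hd
    rcases hc with h | h | h | h | h | h | h <;> obtain ⟨rfl, rfl, rfl⟩ := h <;>
      clear hA h4 <;> interval_cases l <;> first
        | (exfalso; omega)
        | (obtain rfl : g = 8 := by omega
           obtain rfl : ν = 3 := by omega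
           rfl)
  · intro h
    simp only [Prod.mk.injEq] at h
    obtain ⟨rfl, rfl, rfl, rfl, rfl, rfl⟩ := h
    refine ⟨⟨?_, by norm_num, [2, 2], by simp, by simp, by norm_num, by norm_num⟩, ?_⟩
    · unfold Admissible; norm_num
    · unfold LeBarz K3 K2H KH2; norm_num
end

section
/- The 6-tuples (λ, g, ν, Δ, d, a) ∈ ℤ⁶ such that (λ, g, Δ, d, a) ∈ Γ₁₇₄, ν ≥ 0, the Le Barz bound holds, d₃ = 0, d₂ − 1 ≥ 0, and d₁² − d₂·d₀ ≥ 0, is exactly the single tuple (13, 12, 0, 1, 5, 0). -/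
lemma ci_cases_s11 (D s a : ℤ) (k : ℤ) (h : CIFactor D s a) (hs : s = a + k) (hk : k ≤ 3) :
    (D = 1 ∧ k = 0 ∧ a = 0) ∨ (D = 2 ∧ k = 1 ∧ a = 1) ∨ (D = 3 ∧ k = 2 ∧ a = 1) ∨
    (D = 4 ∧ k = 2 ∧ a = 2) ∨ (D = 4 ∧ k = 3 ∧ a = 1) ∨ (D = 6 ∧ k = 3 ∧ a = 2) ∨
    (D = 8 ∧ k = 3 ∧ a = 3) := by
  obtain ⟨e, hl, h2, hp, hsum⟩ := h
  have key : ∀ e : List ℤ, (∀ x ∈ e, 2 ≤ x) → 2 * (e.length : ℤ) ≤ e.sum := by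
    intro e
    induction e with
    | nil => simp
    | cons x t ih =>
      intro h
      have h1 := h x (by simp)
      have h3 := ih (fun y hy => h y (by simp [hy]))
      simp only [List.length_cons, List.sum_cons]
      push_cast
      linarith
  have hlen := key e h2
  match e, hl, h2, hp, hsum, hlen with
  | [], hl, h2, hp, hsum, _ => simp at hl hp hsum; omega
  | [x], hl, h2, hp, hsum, _ =>
    simp at hl hp hsum h2; omega
  | [x, y], hl, h2, hp, hsum, _ =>
    simp at hl hp hsum h2
    obtain ⟨hx, hy⟩ := h2
    have : x ≤ 3 := by omega
    have : y ≤ 3 := by omega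
    interval_cases x <;> interval_cases y <;> omega
  | [x, y, z], hl, h2, hp, hsum, _ =>
    simp at hl hp hsum h2
    obtain ⟨hx, hy, hz⟩ := h2
    obtain rfl : x = 2 := by omega
    obtain rfl : y = 2 := by omega
    obtain rfl : z = 2 := by omega
    omega
  | x :: y :: z :: w :: t, hl, h2, hp, hsum, hlen =>
    simp only [List.length_cons] at hl hlen
    push_cast at hl hlen
    omega

/-- The value of ν forced by `d₃ = 0`. -/
def NU (l g D d a : ℤ) : ℤ := K3 l g D d a + 3 * K2H l g D d a + 3 * KH2 l g + l

/-- The numerical conditions, after eliminating ν (Le Barz bound omitted). -/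
def Cond (l g D d a : ℤ) : Prop :=
    3 ≤ l ∧
    2 * g ≤ ((l - 2) / 3) * (2 * l - 8 - 3 * ((l - 2) / 3 - 1)) ∧
    0 ≤ -21 * l + 6 * g - D * d + 237 ∧
    0 ≤ l ^ 2 + 9 * l - 18 * g + 18 ∧
    0 ≤ l ^ 2 + 7 * l - 10 * g - 2 * (D * d) + 12 * a - 12 * 0 - 92 ∧
    0 ≤ -10 * l + 8 * g + 2 * (D * d) - 12 * a + 12 * 0 + 94 ∧
    0 ≤ -290 * l + 140 * g - 13 * (D * d) + D + 2290 ∧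
    0 ≤ -147 * l + 74 * g + 12 * (D * d) - D - 84 * a + 108 * 0 + 1183 ∧
    0 ≤ 49 * l ^ 2 - 28 * l * g + 4 * g ^ 2 + (D * d - 1106) * l + 316 * g
      - 27 * (D * d) + 6241 ∧
    0 ≤ 7 * D * l - 2 * D * g + D ^ 2 * d ^ 2 - 79 * D ∧
    0 ≤ NU l g D d a ∧
    0 ≤ K2H l g D d a + 2 * KH2 l g + l + NU l g D d a - 1 ∧
    0 ≤ (KH2 l g + l - NU l g D d a) ^ 2
      - (K2H l g D d a + 2 * KH2 l g + l + NU l g D d a) * (l + NU l g D d a)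

instance (l g D d a : ℤ) : Decidable (Cond l g D d a) := by
  delta Cond
  infer_instance

lemma finite_check : ∀ l ∈ List.range 28, ∀ g ∈ List.range 56,
    ∀ t ∈ ([(1, 5, 0), (2, 4, 1), (3, 3, 1), (4, 3, 2), (4, 2, 1), (6, 2, 2), (8, 2, 3)] :
      List (ℤ × ℤ × ℤ)), Cond l g t.1 t.2.1 t.2.2 →
    (l = 13 ∧ g = 12 ∧ t = (1, 5, 0)) ∨ (l = 8 ∧ g = 1 ∧ t = (2, 4, 1)) := by
  decide +kernel

/-- In the proof of Theorem 2.3, the conic bundle case: `d₃ = 0`, `d₂ − 1 ≥ 0` and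
`d₁² − d₂·d₀ ≥ 0` select exactly the tuple `(13, 12, 0, 1, 5, 0)`. -/
theorem conic_bundle_solution (l g ν D d a : ℤ) :
    (Gamma174 l g D d a ∧ 0 ≤ ν ∧ LeBarz l g ν D d a ∧
      K3 l g D d a + 3 * K2H l g D d a + 3 * KH2 l g + l - ν = 0 ∧
      0 ≤ K2H l g D d a + 2 * KH2 l g + l + ν - 1 ∧
      0 ≤ (KH2 l g + l - ν) ^ 2 - (K2H l g D d a + 2 * KH2 l g + l + ν) * (l + ν))
    ↔ (l, g, ν, D, d, a) = (13, 12, 0, 1, 5, 0) := by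
  constructor
  · rintro ⟨⟨hA, hd1, hC⟩, hν, hL, h3, h2, hH⟩
    unfold Admissible at hA
    rw [if_neg hd1] at hA
    obtain ⟨l3, l27, g0, hg, d1, d5, -, -, -, -, -, -, -, c1, c2, c3, c4, c5, c6, c7, c8, c9⟩ := hA
    have hg56 : g < 56 := by linarith
    have hl28 : l < 28 := by linarith
    have hl0 : 0 ≤ l := by linarith
    have hv := ci_cases_s11 D _ a (5 - d) hC (by ring) (by linarith [lt_of_le_of_ne d1 (Ne.symm hd1)])
    have hcase : (D = 1 ∧ d = 5 ∧ a = 0) ∨ (D = 2 ∧ d = 4 ∧ a = 1) ∨ (D = 3 ∧ d = 3 ∧ a = 1) ∨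
        (D = 4 ∧ d = 3 ∧ a = 2) ∨ (D = 4 ∧ d = 2 ∧ a = 1) ∨ (D = 6 ∧ d = 2 ∧ a = 2) ∨
        (D = 8 ∧ d = 2 ∧ a = 3) := by
      have e : ∀ k, 5 - d = k ↔ d = 5 - k := fun k => ⟨fun h => by linarith, fun h => by linarith⟩
      simp only [e] at hv
      norm_num at hv
      exact hv
    have hνe : ν = NU l g D d a := (sub_eq_zero.mp h3).symm
    clear h3
    subst hνe
    have hc : Cond l g D d a := ⟨l3, hg, c2, c3, c6, c7, c8, c9, c4, c5, hν, h2, hH⟩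
    clear hg c1 c2 c3 c4 c5 c6 c7 c8 c9 hν h2 hH hC hv
    lift l to ℕ using hl0
    lift g to ℕ using g0
    have hmem : (D, d, a) ∈ ([(1, 5, 0), (2, 4, 1), (3, 3, 1), (4, 3, 2), (4, 2, 1), (6, 2, 2),
        (8, 2, 3)] : List (ℤ × ℤ × ℤ)) := by
      simpa using hcase
    have := finite_check l (List.mem_range.2 (by exact_mod_cast hl28)) g (List.mem_range.2 (by exact_mod_cast hg56))
      (D, d, a) hmem hc
    simp only [Prod.mk.injEq] at this
    obtain ⟨rfl, rfl, rfl, rfl, rfl⟩ | ⟨rfl, rfl, rfl, rfl, rfl⟩ := this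
    · norm_num [NU, K3, K2H, KH2]
    · norm_num [LeBarz, NU, K3, K2H, KH2] at hL
  · intro h
    simp only [Prod.mk.injEq] at h
    obtain ⟨rfl, rfl, rfl, rfl, rfl, rfl⟩ := h
    refine ⟨⟨?_, by norm_num, [], by simp⟩, ?_⟩
    · norm_num [Admissible]
    · norm_num [LeBarz, K3, K2H, KH2]
end
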